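/- arXiv:quant-ph/0604206 — 4 statements merged into one kernel-verified Lean document; each statement's English description precedes it below -/
import Mathlib

section
/- Let ρ_ABD be a density matrix indexed by (A×B×D)×(A×B×D), with reduced density matrices ρ_AB = Tr_D ρ_ABD, ρ_AD = Tr_B ρ_ABD, ρ_B = Tr_{AD} ρ_ABD, ρ_D = Tr_{AB} ρ_ABD. Then S(ρ_B) + S(ρ_D) ≤ S(ρ_AB) + S(ρ_AD). -/
open Matrix MeasureTheory
open scoped Kronecker ComplexOrder

/-- Matrix logarithm via spectral decomposition of a Hermitian matrix, with the
convention `log 0 = 0` on the kernel (i.e. `log` is taken on the support). -/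
noncomputable def matLog {n : Type*} [Fintype n] [DecidableEq n] (A : Matrix n n ℂ) :
    Matrix n n ℂ := by
  classical
  exact if hA : A.IsHermitian then
    (hA.eigenvectorUnitary : Matrix n n ℂ) *
      Matrix.diagonal (fun i => (Real.log (hA.eigenvalues i) : ℂ)) *
      ((hA.eigenvectorUnitary : Matrix n n ℂ))ᴴ
  else 0

/-- Quantum relative entropy `H(P,Q) = Tr[P (log P - log Q)]`. -/
noncomputable def relEnt {n : Type*} [Fintype n] [DecidableEq n] (P Q : Matrix n n ℂ) : ℝ :=
  ((P * (matLog P - matLog Q)).trace).re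

/-- Von Neumann entropy `S(ρ) = -Tr[ρ log ρ]`. -/
noncomputable def vNEnt {n : Type*} [Fintype n] [DecidableEq n] (ρ : Matrix n n ℂ) : ℝ :=
  -((ρ * matLog ρ).trace).re

/-- Partial trace over the second tensor factor. -/
noncomputable def ptraceB {A B : Type*} [Fintype B] (M : Matrix (A × B) (A × B) ℂ) :
    Matrix A A ℂ :=
  Matrix.of fun a a' => ∑ b : B, M (a, b) (a', b)

section PathLemmas

variable {m n : Type*} [Fintype m] [Fintype n]

theorem hasDerivAt_mul_log_segment {p q t : ℝ} (hp : 0 ≤ p) (hq : 0 ≤ q)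
    (ht : t ∈ Set.Ioo (0 : ℝ) 1)
    {w : ℝ} (hw : q = 0 → w * p = 0) :
    HasDerivAt (fun t => w * (p * Real.log (q + t * (p - q)) - t * (p - q)))
      ((1 - t) * (w * (p - q) ^ 2 / ((1 - t) * q + t * p))) t := by
  obtain ⟨ht0, ht1⟩ := ht
  have ht1' : 0 < 1 - t := sub_pos.2 ht1
  rcases hp.eq_or_lt with rfl | hp
  · have h := ((hasDerivAt_id t).mul_const (0 - q)).const_mul (-w)
    rcases hq.eq_or_lt with rfl | hq
    · simpa using h
    · refine (h.congr_deriv ?_).congr_of_eventuallyEq (.of_forall fun s => by simp)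
      field_simp
      ring
  · rcases hq.eq_or_lt with rfl | hq
    · have : w = 0 := by simpa [hp.ne'] using hw rfl
      simpa [this] using hasDerivAt_const t (0 : ℝ)
    · have hy : 0 < (1 - t) * q + t * p := by positivity
      have hy' : q + t * (p - q) = (1 - t) * q + t * p := by ring
      have hl : HasDerivAt (fun t => t * (p - q)) (1 * (p - q)) t :=
        (hasDerivAt_id t).mul_const (p - q)
      have h :=
        ((((hl.const_add q).log (by rw [hy']; exact hy.ne')).const_mul p).sub hl).const_mul w
      refine h.congr_deriv ?_
      rw [hy']
      field_simp
      ring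

theorem continuousOn_mul_log_segment {p q w : ℝ} (hp : 0 ≤ p) (hq : 0 ≤ q)
    (hw : q = 0 → w * p = 0) :
    ContinuousOn (fun t => w * (p * Real.log (q + t * (p - q)) - t * (p - q)))
      (Set.Icc (0 : ℝ) 1) := by
  rcases hp.eq_or_lt with rfl | hp
  · simp only [zero_mul]
    fun_prop
  · rcases hq.eq_or_lt with rfl | hq
    · have : w = 0 := by simpa [hp.ne'] using hw rfl
      simp only [this, zero_mul]
      fun_prop
    · refine continuousOn_const.mul (.sub (continuousOn_const.mul
        (ContinuousOn.log (by fun_prop) ?_)) (by fun_prop))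
      rintro t ⟨ht0, ht1⟩
      have : q + t * (p - q) = (1 - t) * q + t * p := by ring
      rw [this]
      rcases ht0.eq_or_lt with rfl | ht0
      · simpa using hq.ne'
      · have : 0 ≤ 1 - t := sub_nonneg.2 ht1
        positivity

/-- The concave quadratic functional in `X` whose maximum is
`⟨P - Q, ((1 - t) R_Q + t L_P)⁻¹ (P - Q)⟩`, where `L_P` and `R_Q` are the left and right
multiplication operators. -/
noncomputable def relQuad (t : ℝ) (P Q X : Matrix n n ℂ) : ℝ :=
  2 * ((Xᴴ * P).trace.re - (Xᴴ * Q).trace.re) - (1 - t) * (Xᴴ * X * Q).trace.re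
    - t * (X * Xᴴ * P).trace.re

theorem relQuad_conj_mul_conj [DecidableEq n] (t : ℝ) {U V : Matrix n n ℂ} (hU : Uᴴ * U = 1)
    (hV : Vᴴ * V = 1)
    (p q : n → ℝ) (Y : Matrix n n ℂ) :
    relQuad t (U * diagonal (fun i => (p i : ℂ)) * Uᴴ) (V * diagonal (fun i => (q i : ℂ)) * Vᴴ)
        (U * Y * Vᴴ) =
      ∑ i, ∑ j, (2 * (star (Y i j) * (Uᴴ * V) i j).re * (p i - q j) -
        ((1 - t) * q j + t * p i) * Complex.normSq (Y i j)) := by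
  have h1 : ((U * Y * Vᴴ)ᴴ * (U * diagonal (fun i => (p i : ℂ)) * Uᴴ)).trace
      = (Yᴴ * (diagonal (fun i => (p i : ℂ)) * (Uᴴ * V))).trace := by
    calc _ = (V * (Yᴴ * (Uᴴ * U) * diagonal (fun i => (p i : ℂ)) * Uᴴ)).trace := by
          simp only [conjTranspose_mul, conjTranspose_conjTranspose, Matrix.mul_assoc]
      _ = _ := by rw [hU, trace_mul_comm]; simp only [Matrix.mul_one, Matrix.mul_assoc]
  have h2 : ((U * Y * Vᴴ)ᴴ * (V * diagonal (fun i => (q i : ℂ)) * Vᴴ)).trace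
      = (Yᴴ * ((Uᴴ * V) * diagonal (fun i => (q i : ℂ)))).trace := by
    calc _ = (V * (Yᴴ * (Uᴴ * V) * diagonal (fun i => (q i : ℂ)) * Vᴴ)).trace := by
          simp only [conjTranspose_mul, conjTranspose_conjTranspose, Matrix.mul_assoc]
      _ = (Yᴴ * (Uᴴ * V) * diagonal (fun i => (q i : ℂ)) * (Vᴴ * V)).trace := by
          rw [trace_mul_comm]; simp only [Matrix.mul_assoc]
      _ = _ := by rw [hV]; simp only [Matrix.mul_one, Matrix.mul_assoc]
  have h3 : ((U * Y * Vᴴ)ᴴ * (U * Y * Vᴴ) * (V * diagonal (fun i => (q i : ℂ)) * Vᴴ)).trace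
      = (Yᴴ * (Y * diagonal (fun i => (q i : ℂ)))).trace := by
    calc _ = (V * (Yᴴ * (Uᴴ * U) * Y * (Vᴴ * V) * diagonal (fun i => (q i : ℂ)) * Vᴴ)).trace := by
          simp only [conjTranspose_mul, conjTranspose_conjTranspose, Matrix.mul_assoc]
      _ = (Yᴴ * (Uᴴ * U) * Y * (Vᴴ * V) * diagonal (fun i => (q i : ℂ)) * (Vᴴ * V)).trace := by
          rw [trace_mul_comm]; simp only [Matrix.mul_assoc]
      _ = _ := by rw [hV, hU]; simp only [Matrix.mul_one, Matrix.mul_assoc]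
  have h4 : ((U * Y * Vᴴ) * (U * Y * Vᴴ)ᴴ * (U * diagonal (fun i => (p i : ℂ)) * Uᴴ)).trace
      = (Yᴴ * (diagonal (fun i => (p i : ℂ)) * Y)).trace := by
    calc _ = (U * (Y * (Vᴴ * V) * Yᴴ * (Uᴴ * U) * diagonal (fun i => (p i : ℂ)) * Uᴴ)).trace := by
          simp only [conjTranspose_mul, conjTranspose_conjTranspose, Matrix.mul_assoc]
      _ = (Y * ((Vᴴ * V) * Yᴴ * (Uᴴ * U) * diagonal (fun i => (p i : ℂ)) * (Uᴴ * U))).trace := by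
          rw [trace_mul_comm]; simp only [Matrix.mul_assoc]
      _ = _ := by
          rw [hV, hU, trace_mul_comm]; simp only [Matrix.mul_one, Matrix.one_mul, Matrix.mul_assoc]
  rw [relQuad, h1, h2, h3, h4]
  simp only [trace, diag_apply, Matrix.mul_apply (M := Yᴴ),
    diagonal_mul, mul_diagonal, conjTranspose_apply, Complex.re_sum, Finset.mul_sum,
    ← Finset.sum_sub_distrib]
  rw [Finset.sum_comm]
  refine Finset.sum_congr rfl fun i _ => Finset.sum_congr rfl fun j _ => ?_
  simp [Complex.normSq_apply]
  ring

theorem two_mul_re_mul_sub_le {c d : ℝ} (hd : 0 ≤ d) (hcd : d = 0 → c = 0) (y u : ℂ) :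
    2 * (star y * u).re * c - d * Complex.normSq y ≤ Complex.normSq u * c ^ 2 / d := by
  rcases hd.eq_or_lt with rfl | hd
  · simp [hcd rfl]
  · rw [le_div_iff₀ hd]
    simp only [Complex.normSq_apply, Complex.mul_re, RCLike.star_def, Complex.conj_re,
      Complex.conj_im]
    nlinarith [sq_nonneg (c * u.re - d * y.re), sq_nonneg (c * u.im - d * y.im)]

theorem two_mul_re_mul_sub_eq {c d : ℝ} (hcd : d = 0 → c = 0) (u : ℂ) :
    2 * (star (((c / d : ℝ) : ℂ) * u) * u).re * c - d * Complex.normSq (((c / d : ℝ) : ℂ) * u)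
      = Complex.normSq u * c ^ 2 / d := by
  rcases eq_or_ne d 0 with rfl | hd
  · simp [hcd rfl]
  · simp only [Complex.normSq_apply, Complex.mul_re, Complex.mul_im, RCLike.star_def,
      Complex.conj_re, Complex.conj_im, Complex.ofReal_re, Complex.ofReal_im]
    field_simp
    ring

theorem isGreatest_range_relQuad [DecidableEq n] {t : ℝ} (ht : t ∈ Set.Ioo (0 : ℝ) 1)
    {U V : Matrix n n ℂ}
    (hU : Uᴴ * U = 1) (hV : Vᴴ * V = 1) {p q : n → ℝ} (hp : ∀ i, 0 ≤ p i) (hq : ∀ i, 0 ≤ q i) :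
    IsGreatest (Set.range (relQuad t (U * diagonal (fun i => (p i : ℂ)) * Uᴴ)
        (V * diagonal (fun i => (q i : ℂ)) * Vᴴ)))
      (∑ i, ∑ j, Complex.normSq ((Uᴴ * V) i j) * (p i - q j) ^ 2 / ((1 - t) * q j + t * p i)) := by
  obtain ⟨ht0, ht1⟩ := ht
  have ht1' : 0 < 1 - t := sub_pos.2 ht1
  have hd (i j) : 0 ≤ (1 - t) * q j + t * p i :=
    add_nonneg (mul_nonneg ht1'.le (hq j)) (mul_nonneg ht0.le (hp i))
  have hcd (i j) (h : (1 - t) * q j + t * p i = 0) : p i - q j = 0 := by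
    rw [add_eq_zero_iff_of_nonneg (mul_nonneg ht1'.le (hq j)) (mul_nonneg ht0.le (hp i))] at h
    simp only [mul_eq_zero, ht1'.ne', ht0.ne', false_or] at h
    rw [h.1, h.2, sub_zero]
  constructor
  · refine ⟨U * (of fun i j =>
      (((p i - q j) / ((1 - t) * q j + t * p i) : ℝ) : ℂ) * (Uᴴ * V) i j) * Vᴴ, ?_⟩
    rw [relQuad_conj_mul_conj t hU hV]
    exact Finset.sum_congr rfl fun i _ => Finset.sum_congr rfl fun j _ =>
      two_mul_re_mul_sub_eq (hcd i j) _
  · rintro _ ⟨X, rfl⟩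
    have hX : X = U * (Uᴴ * X * V) * Vᴴ := by
      calc X = (U * Uᴴ) * X * (V * Vᴴ) := by
            rw [mul_eq_one_comm.1 hU, mul_eq_one_comm.1 hV, Matrix.one_mul, Matrix.mul_one]
        _ = _ := by simp only [Matrix.mul_assoc]
    rw [hX, relQuad_conj_mul_conj t hU hV]
    exact Finset.sum_le_sum fun i _ => Finset.sum_le_sum fun j _ =>
      two_mul_re_mul_sub_le (hd i j) (hcd i j) _ _

theorem relQuad_map (φ : Matrix m m ℂ → Matrix n n ℂ) (hmul : ∀ X Y, φ (X * Y) = φ X * φ Y)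
    (hstar : ∀ X, φ Xᴴ = (φ X)ᴴ) {P Q : Matrix n n ℂ} {P' Q' : Matrix m m ℂ}
    (hP : ∀ X, (φ X * P).trace = (X * P').trace) (hQ : ∀ X, (φ X * Q).trace = (X * Q').trace)
    (t : ℝ) (X : Matrix m m ℂ) : relQuad t P Q (φ X) = relQuad t P' Q' X := by
  simp only [relQuad, ← hstar, ← hmul, hP, hQ]

/-- A primitive along the segment from `Q` to `P` whose increment on `[0, 1]` is the relative
entropy `∑ |⟨i|j⟩|² (p log p - p log q - p + q)` of `P` with respect to `Q`. -/
noncomputable def relPath (u : Matrix n n ℂ) (p q : n → ℝ) (t : ℝ) : ℝ :=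
  ∑ i, ∑ j, Complex.normSq (u i j) *
    (p i * Real.log (q j + t * (p i - q j)) - t * (p i - q j))

theorem relPath_sub_le [DecidableEq m] [DecidableEq n] {U V : Matrix n n ℂ} {U' V' : Matrix m m ℂ}
    (hU : Uᴴ * U = 1) (hV : Vᴴ * V = 1) (hU' : U'ᴴ * U' = 1) (hV' : V'ᴴ * V' = 1)
    {p q : n → ℝ} (hp : ∀ i, 0 ≤ p i) (hq : ∀ i, 0 ≤ q i)
    {p' q' : m → ℝ} (hp' : ∀ i, 0 ≤ p' i) (hq' : ∀ i, 0 ≤ q' i)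
    (hsupp : ∀ i j, q j = 0 → Complex.normSq ((Uᴴ * V) i j) * p i = 0)
    (hsupp' : ∀ i j, q' j = 0 → Complex.normSq ((U'ᴴ * V') i j) * p' i = 0)
    (φ : Matrix m m ℂ → Matrix n n ℂ) (hmul : ∀ X Y, φ (X * Y) = φ X * φ Y)
    (hstar : ∀ X, φ Xᴴ = (φ X)ᴴ)
    (hP : ∀ X, (φ X * (U * diagonal (fun i => (p i : ℂ)) * Uᴴ)).trace =
      (X * (U' * diagonal (fun i => (p' i : ℂ)) * U'ᴴ)).trace)
    (hQ : ∀ X, (φ X * (V * diagonal (fun i => (q i : ℂ)) * Vᴴ)).trace =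
      (X * (V' * diagonal (fun i => (q' i : ℂ)) * V'ᴴ)).trace) :
    relPath (U'ᴴ * V') p' q' 1 - relPath (U'ᴴ * V') p' q' 0 ≤
      relPath (Uᴴ * V) p q 1 - relPath (Uᴴ * V) p q 0 := by
  have hderiv (t : ℝ) (ht : t ∈ Set.Ioo (0 : ℝ) 1) :
      HasDerivAt (relPath (Uᴴ * V) p q) (∑ i, ∑ j, (1 - t) *
        (Complex.normSq ((Uᴴ * V) i j) * (p i - q j) ^ 2 / ((1 - t) * q j + t * p i))) t :=
    HasDerivAt.fun_sum fun i _ => HasDerivAt.fun_sum fun j _ =>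
      hasDerivAt_mul_log_segment (hp i) (hq j) ht (hsupp i j)
  have hderiv' (t : ℝ) (ht : t ∈ Set.Ioo (0 : ℝ) 1) :
      HasDerivAt (relPath (U'ᴴ * V') p' q') (∑ i, ∑ j, (1 - t) *
        (Complex.normSq ((U'ᴴ * V') i j) * (p' i - q' j) ^ 2 / ((1 - t) * q' j + t * p' i))) t :=
    HasDerivAt.fun_sum fun i _ => HasDerivAt.fun_sum fun j _ =>
      hasDerivAt_mul_log_segment (hp' i) (hq' j) ht (hsupp' i j)
  have hcont : ContinuousOn (relPath (Uᴴ * V) p q) (Set.Icc 0 1) :=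
    continuousOn_finsetSum _ fun i _ => continuousOn_finsetSum _ fun j _ =>
      continuousOn_mul_log_segment (hp i) (hq j) (hsupp i j)
  have hcont' : ContinuousOn (relPath (U'ᴴ * V') p' q') (Set.Icc 0 1) :=
    continuousOn_finsetSum _ fun i _ => continuousOn_finsetSum _ fun j _ =>
      continuousOn_mul_log_segment (hp' i) (hq' j) (hsupp' i j)
  have hmono : MonotoneOn (fun t => relPath (Uᴴ * V) p q t - relPath (U'ᴴ * V') p' q' t)
      (Set.Icc 0 1) := by
    refine monotoneOn_of_deriv_nonneg (convex_Icc 0 1) (hcont.sub hcont') ?_ ?_ <;>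
      rw [interior_Icc]
    · exact fun t ht => ((hderiv t ht).sub (hderiv' t ht)).differentiableAt.differentiableWithinAt
    · intro t ht
      rw [((hderiv t ht).fun_sub (hderiv' t ht)).deriv]
      simp only [← Finset.mul_sum, ← mul_sub]
      refine mul_nonneg (sub_nonneg.2 ht.2.le) (sub_nonneg.2 ?_)
      obtain ⟨X, hX⟩ := (isGreatest_range_relQuad ht hU' hV' hp' hq').1
      rw [← hX, ← relQuad_map φ hmul hstar hP hQ]
      exact (isGreatest_range_relQuad ht hU hV hp hq).2 ⟨_, rfl⟩
  have := hmono (Set.left_mem_Icc.2 zero_le_one) (Set.right_mem_Icc.2 zero_le_one) zero_le_one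
  dsimp only at this
  linarith

end PathLemmas

section Entropy

variable {m n : Type*} [Fintype m] [DecidableEq m] [Fintype n] [DecidableEq n]

theorem Matrix.IsHermitian.eq_conj_diagonal {A : Matrix n n ℂ} (hA : A.IsHermitian) :
    A = (hA.eigenvectorUnitary : Matrix n n ℂ) * diagonal (fun i => (hA.eigenvalues i : ℂ)) *
      (hA.eigenvectorUnitary : Matrix n n ℂ)ᴴ := by
  conv_lhs => rw [hA.spectral_theorem, Unitary.conjStarAlgAut_apply]
  rfl

theorem vNEnt_eq_sum_negMulLog {A : Matrix n n ℂ} (hA : A.IsHermitian) :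
    vNEnt A = ∑ i, Real.negMulLog (hA.eigenvalues i) := by
  have hU : (hA.eigenvectorUnitary : Matrix n n ℂ)ᴴ * (hA.eigenvectorUnitary : Matrix n n ℂ) = 1 :=
    Unitary.coe_star_mul_self hA.eigenvectorUnitary
  have hlog : matLog A = (hA.eigenvectorUnitary : Matrix n n ℂ) *
      diagonal (fun i => (Real.log (hA.eigenvalues i) : ℂ)) *
      (hA.eigenvectorUnitary : Matrix n n ℂ)ᴴ := dif_pos hA
  have h := hA.eq_conj_diagonal
  rw [vNEnt, hlog]
  generalize (hA.eigenvectorUnitary : Matrix n n ℂ) = U at h hU ⊢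
  generalize hA.eigenvalues = p at h ⊢
  subst h
  have : (U * diagonal (fun i => (p i : ℂ)) * Uᴴ *
      (U * diagonal (fun i => (Real.log (p i) : ℂ)) * Uᴴ)).trace =
      ∑ i, (p i : ℂ) * Real.log (p i) := by
    calc _ = (U * (diagonal (fun i => (p i : ℂ)) * (Uᴴ * U) *
          diagonal (fun i => (Real.log (p i) : ℂ)) * Uᴴ)).trace := by
          simp only [Matrix.mul_assoc]
      _ = (diagonal (fun i => (p i : ℂ)) * (Uᴴ * U) *
          diagonal (fun i => (Real.log (p i) : ℂ)) * (Uᴴ * U)).trace := by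
          rw [trace_mul_comm]; simp only [Matrix.mul_assoc]
      _ = _ := by
          rw [hU, Matrix.mul_one, Matrix.mul_one, diagonal_mul_diagonal, trace_diagonal]
  rw [this, Complex.re_sum, ← Finset.sum_neg_distrib]
  simp [Real.negMulLog]

theorem Matrix.PosSemidef.exists_conj_diagonal {A : Matrix n n ℂ} (hA : A.PosSemidef) :
    ∃ (U : Matrix n n ℂ) (p : n → ℝ), Uᴴ * U = 1 ∧ (∀ i, 0 ≤ p i) ∧
      A = U * diagonal (fun i => (p i : ℂ)) * Uᴴ ∧ vNEnt A = ∑ i, Real.negMulLog (p i) :=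
  ⟨hA.1.eigenvectorUnitary, hA.1.eigenvalues, Unitary.coe_star_mul_self hA.1.eigenvectorUnitary,
    hA.eigenvalues_nonneg, hA.1.eq_conj_diagonal, vNEnt_eq_sum_negMulLog hA.1⟩

theorem Matrix.PosSemidef.exists_eq_mul_conjTranspose {A : Matrix n n ℂ} (hA : A.PosSemidef) :
    ∃ M : Matrix n n ℂ, A = M * Mᴴ := by
  obtain ⟨U, p, -, hp, h, -⟩ := hA.exists_conj_diagonal
  refine ⟨U * diagonal (fun i => (Real.sqrt (p i) : ℂ)), ?_⟩
  have hsqrt : diagonal (fun i => (p i : ℂ)) =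
      diagonal (fun i => (Real.sqrt (p i) : ℂ)) * (diagonal (fun i => (Real.sqrt (p i) : ℂ)))ᴴ := by
    rw [diagonal_conjTranspose, diagonal_mul_diagonal]
    congr 1
    ext i
    simp [← Complex.ofReal_mul, Real.mul_self_sqrt (hp i)]
  rw [h, hsqrt, conjTranspose_mul]
  simp only [Matrix.mul_assoc]

theorem vNEnt_eq_sum_roots_charpoly {A : Matrix n n ℂ} (hA : A.IsHermitian) :
    vNEnt A = (A.charpoly.roots.map fun z : ℂ => Real.negMulLog z.re).sum := by
  rw [vNEnt_eq_sum_negMulLog hA, hA.roots_charpoly_eq_eigenvalues, Multiset.map_map]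
  exact congrArg Multiset.sum (Multiset.map_congr rfl fun i _ => by simp)

theorem vNEnt_transpose {A : Matrix n n ℂ} (hA : A.IsHermitian) : vNEnt Aᵀ = vNEnt A := by
  rw [vNEnt_eq_sum_roots_charpoly hA, vNEnt_eq_sum_roots_charpoly hA.transpose, charpoly_transpose]

theorem vNEnt_mul_conjTranspose (N : Matrix m n ℂ) : vNEnt (N * Nᴴ) = vNEnt (Nᴴ * N) := by
  rw [vNEnt_eq_sum_roots_charpoly (isHermitian_mul_conjTranspose_self N),
    vNEnt_eq_sum_roots_charpoly (isHermitian_conjTranspose_mul_self N)]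
  have hX (k : ℕ) {f : Polynomial ℂ} (hf : f.Monic) :
      ((Polynomial.X ^ k * f).roots.map fun z : ℂ => Real.negMulLog z.re).sum =
        (f.roots.map fun z : ℂ => Real.negMulLog z.re).sum := by
    rw [Polynomial.roots_mul (mul_ne_zero (pow_ne_zero _ Polynomial.X_ne_zero) hf.ne_zero)]
    simp [Multiset.map_nsmul, Multiset.sum_nsmul]
  rw [← hX (Fintype.card n) (charpoly_monic _), charpoly_mul_comm', hX _ (charpoly_monic _)]

end Entropy

section ConditionalEntropy

variable {A B K X : Type*}

/-- Partial trace over the first tensor factor. -/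
noncomputable def ptraceFst {A X : Type*} [Fintype A] (M : Matrix (A × X) (A × X) ℂ) :
    Matrix X X ℂ :=
  of fun x x' => ∑ a : A, M (a, x) (a, x')

/-- Partial trace over the last of three tensor factors. -/
noncomputable def ptraceLast {A B K : Type*} [Fintype K]
    (M : Matrix (A × B × K) (A × B × K) ℂ) : Matrix (A × B) (A × B) ℂ :=
  of fun p q => ∑ k : K, M (p.1, p.2, k) (q.1, q.2, k)

/-- The embedding `X ↦ X ⊗ 1` dual to `ptraceLast`. -/
noncomputable def extendLast {A B : Type*} (K : Type*) [DecidableEq K]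
    (M : Matrix (A × B) (A × B) ℂ) : Matrix (A × B × K) (A × B × K) ℂ :=
  (M ⊗ₖ (1 : Matrix K K ℂ)).submatrix (Equiv.prodAssoc A B K).symm (Equiv.prodAssoc A B K).symm

theorem Matrix.PosSemidef.ptraceFst [Fintype A] {M : Matrix (A × X) (A × X) ℂ} (hM : M.PosSemidef) :
    (ptraceFst M).PosSemidef := by
  have : _root_.ptraceFst M = ∑ a : A, M.submatrix (Prod.mk a) (Prod.mk a) := by
    ext x y
    simp [_root_.ptraceFst, Matrix.sum_apply]
  rw [this]
  exact posSemidef_sum _ fun a _ => hM.submatrix _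

theorem Matrix.PosSemidef.ptraceLast [Fintype K] {M : Matrix (A × B × K) (A × B × K) ℂ}
    (hM : M.PosSemidef) :
    (ptraceLast M).PosSemidef := by
  have : _root_.ptraceLast M = ∑ k : K, M.submatrix (fun p => (p.1, p.2, k))
      (fun p => (p.1, p.2, k)) := by
    ext x y
    simp [_root_.ptraceLast, Matrix.sum_apply]
  rw [this]
  exact posSemidef_sum _ fun a _ => hM.submatrix _

theorem extendLast_mul [Fintype A] [Fintype B] [Fintype K] [DecidableEq K]
    (M N : Matrix (A × B) (A × B) ℂ) :
    extendLast K (M * N) = extendLast K M * extendLast K N := by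
  simp only [extendLast]
  rw [submatrix_mul_equiv, ← mul_kronecker_mul, Matrix.one_mul]

theorem extendLast_conjTranspose [DecidableEq K] (M : Matrix (A × B) (A × B) ℂ) :
    extendLast K Mᴴ = (extendLast K M)ᴴ := by
  simp [extendLast, conjTranspose_submatrix, conjTranspose_kronecker]

theorem trace_extendLast_mul [Fintype A] [Fintype B] [Fintype K] [DecidableEq K]
    (M : Matrix (A × B) (A × B) ℂ)
    (P : Matrix (A × B × K) (A × B × K) ℂ) :
    (extendLast K M * P).trace = (M * ptraceLast P).trace := by
  simp only [trace, diag_apply, Matrix.mul_apply, extendLast, ptraceLast, of_apply,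
    submatrix_apply, kroneckerMap_apply, Equiv.prodAssoc_symm_apply, Fintype.sum_prod_type,
    one_apply, mul_ite, mul_one, mul_zero, ite_mul, zero_mul, Finset.sum_ite_eq, Finset.mem_univ,
    if_true, Finset.mul_sum]
  refine Finset.sum_congr rfl fun a _ => Finset.sum_congr rfl fun b _ => ?_
  rw [Finset.sum_comm]
  refine Finset.sum_congr rfl fun a' _ => ?_
  rw [Finset.sum_comm]

theorem ptraceLast_one_kronecker [DecidableEq A] [Fintype K] (R : Matrix (B × K) (B × K) ℂ) :
    ptraceLast ((1 : Matrix A A ℂ) ⊗ₖ R) = 1 ⊗ₖ ptraceB R := by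
  ext p q
  simp [ptraceLast, ptraceB, Finset.mul_sum]

theorem ptraceFst_ptraceLast [Fintype A] [Fintype K] (P : Matrix (A × B × K) (A × B × K) ℂ) :
    ptraceFst (ptraceLast P) = ptraceB (ptraceFst P) := by
  ext b b'
  simp only [ptraceFst, ptraceLast, ptraceB, of_apply]
  rw [Finset.sum_comm]

theorem trace_ptraceFst [Fintype A] [Fintype X] (P : Matrix (A × X) (A × X) ℂ) :
    (ptraceFst P).trace = P.trace := by
  simp only [trace, ptraceFst, of_apply, diag_apply, Fintype.sum_prod_type]
  rw [Finset.sum_comm]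

theorem trace_ptraceLast [Fintype A] [Fintype B] [Fintype K]
    (P : Matrix (A × B × K) (A × B × K) ℂ) :
    (ptraceLast P).trace = P.trace := by
  simp [trace, ptraceLast, Fintype.sum_prod_type]

theorem one_kronecker_conj_diagonal [Fintype A] [DecidableEq A] [Fintype X] [DecidableEq X]
    (W : Matrix X X ℂ) (r : X → ℝ) :
    ((1 : Matrix A A ℂ) ⊗ₖ W) * diagonal (fun j : A × X => (r j.2 : ℂ)) *
      ((1 : Matrix A A ℂ) ⊗ₖ W)ᴴ = 1 ⊗ₖ (W * diagonal (fun x => (r x : ℂ)) * Wᴴ) := by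
  have : diagonal (fun j : A × X => (r j.2 : ℂ)) =
      (1 : Matrix A A ℂ) ⊗ₖ diagonal (fun x => (r x : ℂ)) := by
    rw [← diagonal_one, diagonal_kronecker_diagonal]
    simp
  rw [this, conjTranspose_kronecker, ← mul_kronecker_mul, ← mul_kronecker_mul]
  simp

theorem ptraceFst_conj_one_kronecker [Fintype A] [DecidableEq A] [Fintype X] (W : Matrix X X ℂ)
    (P : Matrix (A × X) (A × X) ℂ) :
    ptraceFst (((1 : Matrix A A ℂ) ⊗ₖ W)ᴴ * P * ((1 : Matrix A A ℂ) ⊗ₖ W)) =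
      Wᴴ * ptraceFst P * W := by
  ext x y
  simp only [ptraceFst, of_apply, Matrix.mul_apply, conjTranspose_apply, kroneckerMap_apply,
    Fintype.sum_prod_type, one_apply, apply_ite star, star_zero, ite_mul,
    one_mul, zero_mul, mul_ite, mul_zero, Finset.sum_ite_irrel, Finset.sum_const_zero,
    Finset.sum_ite_eq', Finset.mem_univ, if_true, Finset.sum_mul,
    Finset.mul_sum]
  rw [Finset.sum_comm]
  refine Finset.sum_congr rfl fun z _ => ?_
  rw [Finset.sum_comm]

theorem sum_normSq_mul_eq {n : Type*} [Fintype n] [DecidableEq n] (U V : Matrix n n ℂ)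
    (p : n → ℝ) (j : n) :
    ((∑ i, Complex.normSq ((Uᴴ * V) i j) * p i : ℝ) : ℂ) =
      (Vᴴ * (U * diagonal (fun i => (p i : ℂ)) * Uᴴ) * V) j j := by
  have : Vᴴ * (U * diagonal (fun i => (p i : ℂ)) * Uᴴ) * V =
      (Uᴴ * V)ᴴ * diagonal (fun i => (p i : ℂ)) * (Uᴴ * V) := by
    simp only [conjTranspose_mul, conjTranspose_conjTranspose, Matrix.mul_assoc]
  rw [this, Matrix.mul_apply]
  push_cast
  refine Finset.sum_congr rfl fun i _ => ?_
  rw [mul_diagonal, conjTranspose_apply, Complex.normSq_eq_conj_mul_self]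
  simp only [RCLike.star_def]
  ring

theorem sum_normSq_col {n : Type*} [Fintype n] [DecidableEq n] {U : Matrix n n ℂ}
    (hU : Uᴴ * U = 1) (j : n) : ∑ i, Complex.normSq (U i j) = 1 := by
  have := congrFun₂ hU j j
  simp only [Matrix.mul_apply, conjTranspose_apply, one_apply_eq, RCLike.star_def,
    ← Complex.normSq_eq_conj_mul_self] at this
  exact_mod_cast this

theorem sum_normSq_row {n : Type*} [Fintype n] [DecidableEq n] {U : Matrix n n ℂ}
    (hU : U * Uᴴ = 1) (i : n) : ∑ j, Complex.normSq (U i j) = 1 := by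
  have := congrFun₂ hU i i
  simp only [Matrix.mul_apply, conjTranspose_apply, one_apply_eq, RCLike.star_def,
    Complex.mul_conj] at this
  exact_mod_cast this

theorem sum_sum_normSq_mul_eq_of_ptraceFst [Fintype A] [DecidableEq A] [Fintype X] [DecidableEq X]
    {U : Matrix (A × X) (A × X) ℂ} {W : Matrix X X ℂ}
    (hW : Wᴴ * W = 1) {p : A × X → ℝ} {r : X → ℝ}
    (hR : ptraceFst (U * diagonal (fun i => (p i : ℂ)) * Uᴴ) =
      W * diagonal (fun x => (r x : ℂ)) * Wᴴ) (x : X) :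
    ∑ a, ∑ i, Complex.normSq ((Uᴴ * ((1 : Matrix A A ℂ) ⊗ₖ W)) i (a, x)) * p i = r x := by
  have h := congrFun₂ (ptraceFst_conj_one_kronecker W
    (U * diagonal (fun i => (p i : ℂ)) * Uᴴ)) x x
  have h' : Wᴴ * (W * diagonal (fun x => (r x : ℂ)) * Wᴴ) * W = diagonal (fun x => (r x : ℂ)) := by
    calc _ = (Wᴴ * W) * diagonal (fun x => (r x : ℂ)) * (Wᴴ * W) := by
          simp only [Matrix.mul_assoc]
      _ = _ := by rw [hW, Matrix.one_mul, Matrix.mul_one]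
  rw [hR, h', diagonal_apply_eq] at h
  simp only [ptraceFst, of_apply, ← sum_normSq_mul_eq] at h
  exact_mod_cast h

theorem relPath_sub_eq [Fintype A] [DecidableEq A] [Fintype X] [DecidableEq X]
    {U : Matrix (A × X) (A × X) ℂ} {W : Matrix X X ℂ}
    (hU : Uᴴ * U = 1) (hW : Wᴴ * W = 1) {p : A × X → ℝ} {r : X → ℝ}
    (hR : ptraceFst (U * diagonal (fun i => (p i : ℂ)) * Uᴴ) =
      W * diagonal (fun x => (r x : ℂ)) * Wᴴ) :
    relPath (Uᴴ * ((1 : Matrix A A ℂ) ⊗ₖ W)) p (fun j => r j.2) 1 -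
        relPath (Uᴴ * ((1 : Matrix A A ℂ) ⊗ₖ W)) p (fun j => r j.2) 0 =
      ∑ x, Real.negMulLog (r x) - ∑ i, Real.negMulLog (p i) - ∑ i, p i +
        Fintype.card A * ∑ x, r x := by
  have hV : ((1 : Matrix A A ℂ) ⊗ₖ W)ᴴ * ((1 : Matrix A A ℂ) ⊗ₖ W) = 1 := by
    rw [conjTranspose_kronecker, ← mul_kronecker_mul, hW]
    simp
  have hsum := sum_sum_normSq_mul_eq_of_ptraceFst hW hR
  generalize (1 : Matrix A A ℂ) ⊗ₖ W = V at hV hsum ⊢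
  have hu : (Uᴴ * V)ᴴ * (Uᴴ * V) = 1 := by
    calc _ = Vᴴ * (U * Uᴴ) * V := by
          simp only [conjTranspose_mul, conjTranspose_conjTranspose, Matrix.mul_assoc]
      _ = 1 := by rw [mul_eq_one_comm.1 hU, Matrix.mul_one, hV]
  have hcol := sum_normSq_col hu
  have hrow := sum_normSq_row (mul_eq_one_comm.1 hu)
  generalize Uᴴ * V = u at hcol hrow hsum ⊢
  have hlog : ∑ i, ∑ j, Complex.normSq (u i j) * (p i * Real.log (r j.2)) =
      ∑ x, r x * Real.log (r x) := by
    rw [Finset.sum_comm, Fintype.sum_prod_type, Finset.sum_comm]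
    simp only [← hsum, Finset.sum_mul, mul_assoc]
  have hlogp : ∑ i, ∑ j, Complex.normSq (u i j) * (p i * Real.log (p i) - p i) =
      ∑ i, (p i * Real.log (p i) - p i) := by
    simp only [← Finset.sum_mul, hrow, one_mul]
  have hr : ∑ i, ∑ j, Complex.normSq (u i j) * r j.2 = Fintype.card A * ∑ x, r x := by
    rw [Finset.sum_comm]
    simp only [← Finset.sum_mul, hcol, one_mul, Fintype.sum_prod_type, Finset.sum_const,
      Finset.card_univ, nsmul_eq_mul]
  have h1 : relPath u p (fun j => r j.2) 1 =
      ∑ i, (p i * Real.log (p i) - p i) + Fintype.card A * ∑ x, r x := by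
    rw [← hlogp, ← hr, ← Finset.sum_add_distrib]
    simp only [← Finset.sum_add_distrib, relPath]
    refine Finset.sum_congr rfl fun i _ => Finset.sum_congr rfl fun j _ => ?_
    rw [one_mul, add_sub_cancel]
    ring
  have h0 : relPath u p (fun j => r j.2) 0 = ∑ x, r x * Real.log (r x) := by
    rw [← hlog]
    simp [relPath]
  rw [h1, h0]
  simp only [Real.negMulLog, neg_mul, Finset.sum_neg_distrib, Finset.sum_sub_distrib]
  ring

theorem normSq_mul_eq_zero_of_ptraceFst [Fintype A] [DecidableEq A] [Fintype X] [DecidableEq X]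
    {U : Matrix (A × X) (A × X) ℂ} {W : Matrix X X ℂ}
    (hW : Wᴴ * W = 1) {p : A × X → ℝ} (hp : ∀ i, 0 ≤ p i) {r : X → ℝ}
    (hR : ptraceFst (U * diagonal (fun i => (p i : ℂ)) * Uᴴ) =
      W * diagonal (fun x => (r x : ℂ)) * Wᴴ) (i j : A × X) (hj : r j.2 = 0) :
    Complex.normSq ((Uᴴ * ((1 : Matrix A A ℂ) ⊗ₖ W)) i j) * p i = 0 := by
  have h := sum_sum_normSq_mul_eq_of_ptraceFst hW hR j.2
  have hnn (a : A) (i : A × X) :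
      0 ≤ Complex.normSq ((Uᴴ * ((1 : Matrix A A ℂ) ⊗ₖ W)) i (a, j.2)) * p i :=
    mul_nonneg (Complex.normSq_nonneg _) (hp i)
  rw [hj, Finset.sum_eq_zero_iff_of_nonneg fun a _ => Finset.sum_nonneg fun i _ => hnn a i] at h
  have h' := h j.1 (Finset.mem_univ _)
  rw [Finset.sum_eq_zero_iff_of_nonneg fun i _ => hnn _ i] at h'
  exact h' i (Finset.mem_univ _)

theorem trace_conj_diagonal {n : Type*} [Fintype n] [DecidableEq n] {U : Matrix n n ℂ}
    (hU : Uᴴ * U = 1) (p : n → ℝ) :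
    (U * diagonal (fun i => (p i : ℂ)) * Uᴴ).trace = ((∑ i, p i : ℝ) : ℂ) := by
  rw [trace_mul_comm, ← Matrix.mul_assoc, hU, Matrix.one_mul, trace_diagonal]
  push_cast
  rfl

/-- Strong subadditivity of the von Neumann entropy. -/
theorem vNEnt_add_vNEnt_le [Fintype A] [DecidableEq A] [Fintype B] [DecidableEq B] [Fintype K]
    [DecidableEq K] {P : Matrix (A × B × K) (A × B × K) ℂ} (hP : P.PosSemidef) :
    vNEnt P + vNEnt (ptraceFst (ptraceLast P)) ≤
      vNEnt (ptraceLast P) + vNEnt (ptraceFst P) := by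
  have htrace := trace_ptraceLast P
  have htraceR := trace_ptraceFst P
  have htraceR' := trace_ptraceFst (ptraceLast P)
  obtain ⟨U, p, hU, hp, hPU, hSP⟩ := hP.exists_conj_diagonal
  obtain ⟨U', p', hU', hp', hPU', hSP'⟩ := hP.ptraceLast.exists_conj_diagonal
  obtain ⟨W, r, hW, hr, hRW, hSR⟩ := hP.ptraceFst.exists_conj_diagonal
  obtain ⟨W', r', hW', hr', hRW', hSR'⟩ := hP.ptraceLast.ptraceFst.exists_conj_diagonal
  have hV : ((1 : Matrix A A ℂ) ⊗ₖ W)ᴴ * ((1 : Matrix A A ℂ) ⊗ₖ W) = 1 := by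
    rw [conjTranspose_kronecker, ← mul_kronecker_mul, hW]
    simp
  have hV' : ((1 : Matrix A A ℂ) ⊗ₖ W')ᴴ * ((1 : Matrix A A ℂ) ⊗ₖ W') = 1 := by
    rw [conjTranspose_kronecker, ← mul_kronecker_mul, hW']
    simp
  have hR : ptraceFst (U * diagonal (fun i => (p i : ℂ)) * Uᴴ) =
      W * diagonal (fun x => (r x : ℂ)) * Wᴴ := by rw [← hPU, ← hRW]
  have hR' : ptraceFst (U' * diagonal (fun i => (p' i : ℂ)) * U'ᴴ) =
      W' * diagonal (fun x => (r' x : ℂ)) * W'ᴴ := by rw [← hPU', ← hRW']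
  have key := relPath_sub_le hU hV hU' hV' hp (q := fun j => r j.2) (fun j => hr j.2) hp'
    (q' := fun j => r' j.2) (fun j => hr' j.2) (normSq_mul_eq_zero_of_ptraceFst hW hp hR)
    (normSq_mul_eq_zero_of_ptraceFst hW' hp' hR') (extendLast K) extendLast_mul
    extendLast_conjTranspose
    (fun M => by rw [← hPU, ← hPU', trace_extendLast_mul])
    (fun M => by
      rw [one_kronecker_conj_diagonal, one_kronecker_conj_diagonal, trace_extendLast_mul,
        ptraceLast_one_kronecker, ← hRW, ← hRW', ptraceFst_ptraceLast])
  rw [relPath_sub_eq hU hW hR, relPath_sub_eq hU' hW' hR', ← hSP, ← hSP', ← hSR, ← hSR'] at key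
  have hp_eq : (P.trace = ((∑ i, p i : ℝ) : ℂ)) := by
    rw [← trace_conj_diagonal hU, ← hPU]
  have hp'_eq : ((ptraceLast P).trace = ((∑ i, p' i : ℝ) : ℂ)) := by
    rw [← trace_conj_diagonal hU', ← hPU']
  have hr_eq : ((ptraceFst P).trace = ((∑ i, r i : ℝ) : ℂ)) := by
    rw [← trace_conj_diagonal hW, ← hRW]
  have hr'_eq : ((ptraceFst (ptraceLast P)).trace = ((∑ i, r' i : ℝ) : ℂ)) := by
    rw [← trace_conj_diagonal hW', ← hRW']
  have e1 : ∑ i, p' i = ∑ i, p i := by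
    exact_mod_cast hp'_eq.symm.trans (htrace.trans hp_eq)
  have e2 : ∑ i, r i = ∑ i, p i := by
    exact_mod_cast hr_eq.symm.trans (htraceR.trans hp_eq)
  have e3 : ∑ i, r' i = ∑ i, p i := by
    exact_mod_cast hr'_eq.symm.trans (htraceR'.trans (htrace.trans hp_eq))
  rw [e1, e2, e3] at key
  linarith

end ConditionalEntropy


/-- The alternative form of strong subadditivity:
`S(ρ_B) + S(ρ_D) ≤ S(ρ_AB) + S(ρ_AD)`. -/
theorem strong_subadditivity' {dA dB dD : ℕ}
    (ρ : Matrix (Fin dA × Fin dB × Fin dD) (Fin dA × Fin dB × Fin dD) ℂ)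
    (hρ : ρ.PosSemidef) (hρ1 : ρ.trace = 1) :
    vNEnt (Matrix.of fun (b b' : Fin dB) =>
        ∑ a : Fin dA, ∑ d : Fin dD, ρ (a, b, d) (a, b', d)) +
      vNEnt (Matrix.of fun (e e' : Fin dD) =>
        ∑ a : Fin dA, ∑ b : Fin dB, ρ (a, b, e) (a, b, e')) ≤
    vNEnt (Matrix.of fun (p q : Fin dA × Fin dB) =>
        ∑ e : Fin dD, ρ (p.1, p.2, e) (q.1, q.2, e)) +
      vNEnt (Matrix.of fun (p q : Fin dA × Fin dD) =>
        ∑ b : Fin dB, ρ (p.1, b, p.2) (q.1, b, q.2)) := by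
  obtain ⟨M, rfl⟩ := hρ.exists_eq_mul_conjTranspose
  -- `M` is a purification of `ρ`; `N` and `L` are its two bipartite matricizations.
  let N : Matrix (Fin dA × Fin dB × (Fin dA × Fin dB × Fin dD)) (Fin dD) ℂ :=
    of fun x d => M (x.1, x.2.1, d) x.2.2
  let L : Matrix (Fin dA × Fin dD) (Fin dB × (Fin dA × Fin dB × Fin dD)) ℂ :=
    of fun x y => M (x.1, y.1, x.2) y.2
  have hSSA := vNEnt_add_vNEnt_le (posSemidef_self_mul_conjTranspose N)
  have hBK : ptraceFst (N * Nᴴ) = (Lᴴ * L)ᵀ := by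
    ext x y
    simp [ptraceFst, N, L, Matrix.mul_apply, Fintype.sum_prod_type, mul_comm]
  rw [hBK, vNEnt_transpose (isHermitian_conjTranspose_mul_self L), ← vNEnt_mul_conjTranspose L,
    vNEnt_mul_conjTranspose N, ← vNEnt_transpose (isHermitian_conjTranspose_mul_self N)] at hSSA
  rw [add_comm (vNEnt _) (vNEnt _)]
  convert hSSA using 3
  · ext d d'
    simp [N, Matrix.mul_apply, Fintype.sum_prod_type, mul_comm]
  · ext b b'
    simp only [ptraceFst, ptraceLast, N, Matrix.mul_apply, of_apply, conjTranspose_apply]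
    exact Finset.sum_congr rfl fun a _ => Finset.sum_comm
  · ext x y
    simp only [ptraceLast, N, Matrix.mul_apply, of_apply, conjTranspose_apply]
    exact Finset.sum_comm
  · ext x y
    simp [L, Matrix.mul_apply, Fintype.sum_prod_type]
end

section
/- Operator Cauchy–Schwarz inequality of Lieb–Ruskai: let P_1,…,P_n be positive definite d×d complex matrices and A_1,…,A_n arbitrary d×d complex matrices. Then, in the Loewner (positive semidefinite) order, (Σ_k A_k)† (Σ_k P_k)^{−1} (Σ_k A_k) ≤ Σ_k A_k† P_k^{−1} A_k. Equivalently, the map (A,P) ↦ A† P^{−1} A is jointly operator convex. -/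
open Matrix MeasureTheory
open scoped Kronecker ComplexOrder

/-- The sum of block matrices is the block matrix of the sums. -/
theorem Matrix.sum_fromBlocks {ι l m n o α : Type*} [AddCommMonoid α] (s : Finset ι)
    (A : ι → Matrix n l α) (B : ι → Matrix n m α) (C : ι → Matrix o l α) (D : ι → Matrix o m α) :
    ∑ k ∈ s, fromBlocks (A k) (B k) (C k) (D k) =
      fromBlocks (∑ k ∈ s, A k) (∑ k ∈ s, B k) (∑ k ∈ s, C k) (∑ k ∈ s, D k) := by
  classical
  induction s using Finset.induction_on with
  | empty => simp
  | insert k s hk ih => simp only [Finset.sum_insert hk, ih, fromBlocks_add]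

/-- The block matrix with positive definite corner `P` and vanishing Schur complement is
positive semidefinite. -/
theorem Matrix.PosDef.posSemidef_fromBlocks {m n : Type*} [Fintype m] [DecidableEq m] [Fintype n]
    {P : Matrix m m ℂ} (hP : P.PosDef) (A : Matrix m n ℂ) :
    (fromBlocks P A Aᴴ (Aᴴ * P⁻¹ * A)).PosSemidef := by
  have : Invertible P := hP.isUnit.invertible
  rw [PosDef.fromBlocks₁₁ _ _ hP, sub_self]
  exact PosSemidef.zero

/-- Operator Cauchy–Schwarz inequality of Lieb–Ruskai: in the Loewner order,
`(∑ₖ Aₖ)† (∑ₖ Pₖ)⁻¹ (∑ₖ Aₖ) ≤ ∑ₖ Aₖ† Pₖ⁻¹ Aₖ`. -/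
theorem lieb_ruskai_cauchy_schwarz {d n : ℕ}
    (P A : Fin n → Matrix (Fin d) (Fin d) ℂ) (hP : ∀ k, (P k).PosDef) :
    ((∑ k, (A k)ᴴ * (P k)⁻¹ * A k) -
      (∑ k, A k)ᴴ * (∑ k, P k)⁻¹ * (∑ k, A k)).PosSemidef := by
  rcases isEmpty_or_nonempty (Fin n) with _ | hn
  · simpa using PosSemidef.zero
  have hS : (∑ k, P k).PosDef := posDef_sum Finset.univ_nonempty fun k _ => hP k
  have : Invertible (∑ k, P k) := hS.isUnit.invertible
  rw [← PosDef.fromBlocks₁₁ _ _ hS, conjTranspose_sum, ← sum_fromBlocks]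
  exact posSemidef_sum _ fun k _ => (hP k).posSemidef_fromBlocks (A k)
end

section
/- Schwarz inequality for completely positive maps: let Φ(X) = Σ_j K_j X K_j† with K_j arbitrary d'×d complex matrices (a completely positive map). Let P be a positive definite d×d matrix such that Φ(P) is positive definite, and let A be any d×d matrix. Then, in the Loewner order, Φ(A)† · Φ(P)^{−1} · Φ(A) ≤ Φ(A† P^{−1} A). -/
open Matrix MeasureTheory
open scoped Kronecker ComplexOrder

/-- Schwarz inequality for completely positive maps `Φ(X) = ∑ⱼ Kⱼ X Kⱼᴴ`:
`Φ(A)† Φ(P)⁻¹ Φ(A) ≤ Φ(A† P⁻¹ A)` in the Loewner order. -/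
theorem CP_schwarz {d d' m : ℕ} (K : Fin m → Matrix (Fin d') (Fin d) ℂ)
    (P : Matrix (Fin d) (Fin d) ℂ) (hP : P.PosDef)
    (hΦP : (∑ j, K j * P * (K j)ᴴ).PosDef)
    (A : Matrix (Fin d) (Fin d) ℂ) :
    ((∑ j, K j * (Aᴴ * P⁻¹ * A) * (K j)ᴴ) -
      (∑ j, K j * A * (K j)ᴴ)ᴴ * (∑ j, K j * P * (K j)ᴴ)⁻¹ *
        (∑ j, K j * A * (K j)ᴴ)).PosSemidef := by
  have := hP.isUnit.invertible
  have := hΦP.isUnit.invertible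
  rw [← PosDef.fromBlocks₁₁ _ _ hΦP]
  have hM : (fromBlocks P A Aᴴ (Aᴴ * P⁻¹ * A)).PosSemidef := by
    rw [PosDef.fromBlocks₁₁ _ _ hP, sub_self]
    exact PosSemidef.zero
  have hsum : fromBlocks (∑ j, K j * P * (K j)ᴴ) (∑ j, K j * A * (K j)ᴴ)
      (∑ j, K j * A * (K j)ᴴ)ᴴ (∑ j, K j * (Aᴴ * P⁻¹ * A) * (K j)ᴴ) =
      ∑ j, fromBlocks (K j) 0 0 (K j) * fromBlocks P A Aᴴ (Aᴴ * P⁻¹ * A) *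
        (fromBlocks (K j) 0 0 (K j))ᴴ := by
    ext (i | i) (k | k) <;>
      simp [fromBlocks_multiply, fromBlocks_conjTranspose, Matrix.sum_apply,
        conjTranspose_sum, Matrix.mul_assoc]
  rw [hsum]
  exact posSemidef_sum _ fun j _ => hM.mul_mul_conjTranspose_same _
end

section
/- Let Φ(X) = Σ_j K_j X K_j† with K_j arbitrary d'×d complex matrices (a completely positive map), and let A, B be d×d complex matrices with B invertible and Φ(B†B) positive definite. Then, in the Loewner order, Φ(A†B) · Φ(B†B)^{−1} · Φ(B†A) ≤ Φ(A†A). -/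
open Matrix MeasureTheory
open scoped Kronecker ComplexOrder

/-- Expansion of `∑ (Xⱼ - Yⱼ C)ᴴ (Xⱼ - Yⱼ C)` at the minimizer `C = (∑ Yⱼᴴ Yⱼ)⁻¹ ∑ Yⱼᴴ Xⱼ`:
the Schwarz inequality for matrix-valued Gram sums. -/
theorem posSemidef_gram_schwarz {ι k n p : Type*} [Fintype ι] [Fintype k] [Fintype n]
    [Fintype p] [DecidableEq n] (X : ι → Matrix k p ℂ) (Y : ι → Matrix k n ℂ)
    (hY : IsUnit (∑ j, (Y j)ᴴ * Y j)) :
    ((∑ j, (X j)ᴴ * X j) -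
      (∑ j, (X j)ᴴ * Y j) * (∑ j, (Y j)ᴴ * Y j)⁻¹ * (∑ j, (Y j)ᴴ * X j)).PosSemidef := by
  set S := ∑ j, (Y j)ᴴ * Y j with hS
  set R := ∑ j, (Y j)ᴴ * X j with hR
  set T := ∑ j, (X j)ᴴ * Y j with hT
  set C := S⁻¹ * R with hC
  have hSC : S * C = R := by
    rw [hC, ← Matrix.mul_assoc, Matrix.mul_nonsing_inv _ ((Matrix.isUnit_iff_isUnit_det S).1 hY),
      Matrix.one_mul]
  have hsum : ∑ j, (X j - Y j * C)ᴴ * (X j - Y j * C) =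
      (∑ j, (X j)ᴴ * X j) - T * C - Cᴴ * R + Cᴴ * (S * C) := by
    simp only [hS, hR, hT, Matrix.sum_mul, Matrix.mul_sum, ← Finset.sum_sub_distrib,
      ← Finset.sum_add_distrib]
    refine Finset.sum_congr rfl fun j _ => ?_
    simp only [conjTranspose_sub, conjTranspose_mul, Matrix.sub_mul, Matrix.mul_sub,
      Matrix.mul_assoc]
    abel
  rw [hSC, sub_add_cancel, hC, ← Matrix.mul_assoc] at hsum
  rw [← hsum]
  exact posSemidef_sum _ fun j _ => posSemidef_conjTranspose_mul_self _

/-- For a completely positive map `Φ(X) = ∑ⱼ Kⱼ X Kⱼᴴ`: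
`Φ(A†B) Φ(B†B)⁻¹ Φ(B†A) ≤ Φ(A†A)` in the Loewner order. -/
theorem CP_schwarz_AB {d d' m : ℕ} (K : Fin m → Matrix (Fin d') (Fin d) ℂ)
    (A B : Matrix (Fin d) (Fin d) ℂ) (hB : IsUnit B)
    (hΦ : (∑ j, K j * (Bᴴ * B) * (K j)ᴴ).PosDef) :
    ((∑ j, K j * (Aᴴ * A) * (K j)ᴴ) -
      (∑ j, K j * (Aᴴ * B) * (K j)ᴴ) * (∑ j, K j * (Bᴴ * B) * (K j)ᴴ)⁻¹ *
        (∑ j, K j * (Bᴴ * A) * (K j)ᴴ)).PosSemidef := by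
  have h := posSemidef_gram_schwarz (fun j => A * (K j)ᴴ) (fun j => B * (K j)ᴴ)
  simp only [conjTranspose_mul, conjTranspose_conjTranspose, Matrix.mul_assoc] at h hΦ ⊢
  exact h hΦ.isUnit
end
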